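/- Let H be a real Hilbert space, let α > 0, γ > 0, κ > 0, q > 1, set q* = q/(q−1) and ρ = (κ/q)^{q*−1}, and define φ : H → ℝ by φ(x) = α + ‖x‖^q/κ. Let σ ∈ ℝ and x ∈ H. If q* γ^{q*−1} σ + ρ‖x‖^{q*} ≤ q* γ^{q*} α, then prox_{γφ̃}(σ,x) = (0,0). If q* γ^{q*−1} σ + ρ‖x‖^{q*} > q* γ^{q*} α and x ≠ 0, then the equation t^{2q*−1} + (q*(σ−γα)/(γρ)) t^{q*−1} + (q*/ρ²) t − q*‖x‖/(γρ²) = 0 has a unique solution t in (0,∞), and, setting p = t x/‖x‖, one has prox_{γφ̃}(σ,x) = (σ + γ(ρ t^{q*}/q* − α), x − γp). If q* γ^{q*−1} σ + ρ‖x‖^{q*} > q* γ^{q*} α and x = 0, then prox_{γφ̃}(σ,0) = (σ − γα, 0). -/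

import Mathlib

noncomputable section

/-- The perspective of a (finite-valued) function `φ : H → ℝ`: it equals
`σ φ(x/σ)` for `σ > 0`, the recession function
`(rec φ)(x) = sup_y (φ(x+y) − φ(y))` for `σ = 0`, and `+∞` for `σ < 0`. -/
def perspR {H : Type*} [NormedAddCommGroup H] [NormedSpace ℝ H]
    (φ : H → ℝ) (p : ℝ × H) : EReal :=
  if 0 < p.1 then ((p.1 * φ (p.1⁻¹ • p.2) : ℝ) : EReal)
  else if p.1 = 0 then ⨆ y : H, ((φ (p.2 + y) - φ y : ℝ) : EReal)
  else ⊤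

/-- `p` is the proximal point of `ψ : ℝ × H → (−∞,∞]` at `z`, i.e. `p` minimizes
`y ↦ ψ(y) + ½‖z − y‖²` (the squared norm on `ℝ × H` being the Hilbert one). -/
def IsProx {H : Type*} [NormedAddCommGroup H]
    (ψ : ℝ × H → EReal) (z p : ℝ × H) : Prop :=
  ∀ y : ℝ × H,
    ψ p + ((((z.1 - p.1) ^ 2 + ‖z.2 - p.2‖ ^ 2) / 2 : ℝ) : EReal) ≤
      ψ y + ((((z.1 - y.1) ^ 2 + ‖z.2 - y.2‖ ^ 2) / 2 : ℝ) : EReal)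

section helpers

theorem gsl_young (κ q qs ρ : ℝ) (hκ : 0 < κ) (hq : 1 < q)
    (hqs : qs = q / (q - 1)) (hρ : ρ = (κ / q) ^ (qs - 1)) (a b : ℝ) (ha : 0 ≤ a) (hb : 0 ≤ b) :
    a * b ≤ a ^ q / κ + ρ * b ^ qs / qs := by
  have hq0 : 0 < q := by linarith
  have hc : q.HolderConjugate qs := by
    rw [hqs]; exact Real.HolderConjugate.conjExponent hq
  have hk : 0 < κ / q := by positivity
  have h := Real.young_inequality_of_nonneg (a := a * (κ / q) ^ (-(1 / q)))
    (b := b * (κ / q) ^ (1 / q)) (by positivity) (by positivity) hc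
  have e1 : (κ / q) ^ (-(1 / q)) * (κ / q) ^ (1 / q) = 1 := by
    rw [← Real.rpow_add hk]; simp
  have e2 : (a * (κ / q) ^ (-(1 / q))) ^ q / q = a ^ q / κ := by
    rw [Real.mul_rpow ha (by positivity), ← Real.rpow_mul hk.le]
    have : -(1 / q) * q = -1 := by field_simp
    rw [this, Real.rpow_neg_one]; field_simp
  have e3 : (b * (κ / q) ^ (1 / q)) ^ qs = ρ * b ^ qs := by
    rw [Real.mul_rpow hb (by positivity), ← Real.rpow_mul hk.le, hρ]
    have h1 : q - 1 ≠ 0 := by linarith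
    have : 1 / q * qs = qs - 1 := by rw [hqs]; field_simp; ring
    rw [this, mul_comm]
  rw [e2, e3] at h
  calc a * b = a * (κ / q) ^ (-(1 / q)) * (b * (κ / q) ^ (1 / q)) := by
        linear_combination (-(a * b)) * e1
    _ ≤ _ := h

theorem gsl_young_eq (κ q qs ρ : ℝ) (hκ : 0 < κ) (hq : 1 < q)
    (hqs : qs = q / (q - 1)) (hρ : ρ = (κ / q) ^ (qs - 1)) (b : ℝ) (hb : 0 < b) :
    (ρ * b ^ (qs - 1)) ^ q / κ + ρ * b ^ qs / qs = ρ * b ^ qs := by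
  have hq0 : 0 < q := by linarith
  have h1 : q - 1 ≠ 0 := by linarith
  have hk : 0 < κ / q := by positivity
  have hρ0 : 0 < ρ := by rw [hρ]; positivity
  have hm : (qs - 1) * q = qs := by rw [hqs]; field_simp; ring
  have e : ρ ^ q = ρ * (κ / q) := by
    rw [hρ, ← Real.rpow_mul hk.le, hm, Real.rpow_sub_one hk.ne']
    field_simp
  rw [Real.mul_rpow hρ0.le (by positivity), ← Real.rpow_mul hb.le, hm, e, hqs]
  field_simp
  ring

variable {H : Type*} [NormedAddCommGroup H] [InnerProductSpace ℝ H]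

theorem gsl_fy (α κ q qs ρ : ℝ) (hκ : 0 < κ) (hq : 1 < q)
    (hqs : qs = q / (q - 1)) (hρ : ρ = (κ / q) ^ (qs - 1)) (v u : H) :
    inner ℝ v u - (ρ * ‖u‖ ^ qs / qs - α) ≤ α + ‖v‖ ^ q / κ := by
  have h1 := gsl_young κ q qs ρ hκ hq hqs hρ ‖v‖ ‖u‖ (norm_nonneg _) (norm_nonneg _)
  have h2 := real_inner_le_norm v u
  linarith

theorem gsl_fy_eq (α κ q qs ρ : ℝ) (hκ : 0 < κ) (hq : 1 < q)
    (hqs : qs = q / (q - 1)) (hρ : ρ = (κ / q) ^ (qs - 1)) (u : H) :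
    α + ‖(ρ * ‖u‖ ^ (qs - 2)) • u‖ ^ q / κ =
      inner ℝ ((ρ * ‖u‖ ^ (qs - 2)) • u) u - (ρ * ‖u‖ ^ qs / qs - α) := by
  have hqs0 : 0 < qs := by rw [hqs]; exact div_pos (by linarith) (by linarith)
  have hk : 0 < κ / q := div_pos hκ (by linarith)
  have hρ0 : 0 < ρ := by rw [hρ]; positivity
  by_cases hu : u = 0
  · subst hu
    simp [Real.zero_rpow hqs0.ne', Real.zero_rpow (show q ≠ 0 by linarith)]
  · have hn : 0 < ‖u‖ := norm_pos_iff.mpr hu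
    have h := gsl_young_eq κ q qs ρ hκ hq hqs hρ ‖u‖ hn
    have e1 : ‖u‖ ^ (qs - 1) = ‖u‖ ^ (qs - 2) * ‖u‖ := by
      rw [← Real.rpow_add_one hn.ne']; congr 1; ring
    have e2 : ‖u‖ ^ qs = ‖u‖ ^ (qs - 2) * ‖u‖ * ‖u‖ := by
      rw [← e1, ← Real.rpow_add_one hn.ne']; congr 1; ring
    rw [norm_smul, inner_smul_left, real_inner_self_eq_norm_sq, Real.norm_of_nonneg (by positivity),
      mul_assoc, ← e1]
    simp only [conj_trivial]
    have : ρ * ‖u‖ ^ (qs - 2) * ‖u‖ ^ 2 = ρ * ‖u‖ ^ qs := by rw [e2]; ring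
    linarith

theorem gsl_lower (α κ q qs ρ : ℝ) (hκ : 0 < κ) (hq : 1 < q)
    (hqs : qs = q / (q - 1)) (hρ : ρ = (κ / q) ^ (qs - 1)) (μ : ℝ) (u : H)
    (hC : μ + (ρ * ‖u‖ ^ qs / qs - α) ≤ 0) (w : ℝ × H) :
    ((w.1 * μ + inner ℝ w.2 u : ℝ) : EReal) ≤ perspR (fun v : H => α + ‖v‖ ^ q / κ) w := by
  unfold perspR
  split_ifs with h1 h2
  · rw [EReal.coe_le_coe_iff]
    have h := gsl_fy α κ q qs ρ hκ hq hqs hρ (w.1⁻¹ • w.2) u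
    have e : inner ℝ w.2 u = w.1 * inner ℝ (w.1⁻¹ • w.2) u := by
      rw [inner_smul_left]; simp only [conj_trivial]; field_simp
    rw [e, ← mul_add]
    exact mul_le_mul_of_nonneg_left (by linarith) h1.le
  · refine le_trans ?_ (le_iSup _ ((ρ * ‖u‖ ^ (qs - 2)) • u))
    rw [EReal.coe_le_coe_iff]
    have ha := gsl_fy α κ q qs ρ hκ hq hqs hρ (w.2 + (ρ * ‖u‖ ^ (qs - 2)) • u) u
    have hb := gsl_fy_eq α κ q qs ρ hκ hq hqs hρ u
    rw [inner_add_left] at ha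
    rw [h2]
    linarith
  · exact le_top

theorem gsl_eq (α κ q qs ρ : ℝ) (hκ : 0 < κ) (hq : 1 < q)
    (hqs : qs = q / (q - 1)) (hρ : ρ = (κ / q) ^ (qs - 1)) (u p2 : H) (η : ℝ) (hη : 0 < η)
    (hp : p2 = η • ((ρ * ‖u‖ ^ (qs - 2)) • u)) :
    perspR (fun v : H => α + ‖v‖ ^ q / κ) (η, p2) =
      ((η * (α - ρ * ‖u‖ ^ qs / qs) + inner ℝ p2 u : ℝ) : EReal) := by
  unfold perspR
  rw [if_pos hη]
  have hb := gsl_fy_eq α κ q qs ρ hκ hq hqs hρ u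
  have e : η⁻¹ • p2 = (ρ * ‖u‖ ^ (qs - 2)) • u := by
    rw [hp, smul_smul η⁻¹, inv_mul_cancel₀ hη.ne', one_smul]
  simp only [e]
  rw [hb, hp, inner_smul_left _ _ η]
  simp only [conj_trivial]
  congr 1
  ring

theorem gsl_zero (α κ q : ℝ) (hq : 1 < q) :
    perspR (fun v : H => α + ‖v‖ ^ q / κ) (0, 0) = 0 := by
  simp [perspR]

theorem gsl_prox (f : ℝ × H → EReal) (γ : ℝ) (hγ : 0 < γ) (z p : ℝ × H) (μ : ℝ) (u : H)
    (h1 : z.1 - p.1 = γ * μ) (h2 : z.2 - p.2 = γ • u)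
    (hp : f p = ((p.1 * μ + inner ℝ p.2 u : ℝ) : EReal))
    (hf : ∀ w, ((w.1 * μ + inner ℝ w.2 u : ℝ) : EReal) ≤ f w) (p' : ℝ × H) :
    IsProx (fun w => (γ : EReal) * f w) z p' ↔ p' = p := by
  have key : ∀ y : ℝ × H,
      ((γ * (p.1 * μ + inner ℝ p.2 u) + ((z.1 - p.1) ^ 2 + ‖z.2 - p.2‖ ^ 2) / 2
        + ((y.1 - p.1) ^ 2 + ‖y.2 - p.2‖ ^ 2) / 2 : ℝ) : EReal) ≤
      (γ : EReal) * f y + ((((z.1 - y.1) ^ 2 + ‖z.2 - y.2‖ ^ 2) / 2 : ℝ) : EReal) := by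
    intro y
    have h3 : (γ : EReal) * ((y.1 * μ + inner ℝ y.2 u : ℝ) : EReal) ≤ (γ : EReal) * f y :=
      mul_le_mul_of_nonneg_left (hf y) (by exact_mod_cast hγ.le)
    refine le_trans (le_of_eq ?_) (add_le_add_left h3 _)
    rw [← EReal.coe_mul, ← EReal.coe_add]
    congr 1
    have e : z.2 - y.2 = γ • u - (y.2 - p.2) := by rw [← h2]; abel
    have e1 : z.1 - y.1 = γ * μ - (y.1 - p.1) := by rw [← h1]; ring
    rw [e, e1, h1, h2, norm_sub_sq_real (γ • u), inner_smul_left, inner_sub_right,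
      real_inner_comm u y.2, real_inner_comm u p.2]
    simp only [conj_trivial]
    rw [real_inner_comm y.2 u, real_inner_comm p.2 u]
    ring
  have hval : (γ : EReal) * f p + ((((z.1 - p.1) ^ 2 + ‖z.2 - p.2‖ ^ 2) / 2 : ℝ) : EReal) =
      ((γ * (p.1 * μ + inner ℝ p.2 u) + ((z.1 - p.1) ^ 2 + ‖z.2 - p.2‖ ^ 2) / 2 : ℝ) : EReal) := by
    rw [hp, ← EReal.coe_mul, ← EReal.coe_add]
  constructor
  · intro h
    have h3 := (key p').trans (h p)
    simp only at h3
    rw [hval, EReal.coe_le_coe_iff] at h3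
    have h4 : (p'.1 - p.1) ^ 2 = 0 := by nlinarith [sq_nonneg (p'.1 - p.1), sq_nonneg ‖p'.2 - p.2‖]
    have h5 : ‖p'.2 - p.2‖ ^ 2 = 0 := by
      nlinarith [sq_nonneg (p'.1 - p.1), sq_nonneg ‖p'.2 - p.2‖]
    ext1
    · exact sub_eq_zero.mp (by simpa using h4)
    · exact sub_eq_zero.mp (by simpa using h5)
  · rintro rfl y
    simp only
    rw [hval]
    refine le_trans ?_ (key y)
    rw [EReal.coe_le_coe_iff]
    nlinarith [sq_nonneg (y.1 - p'.1), sq_nonneg ‖y.2 - p'.2‖]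

/-- the scalar equation, rewritten -/
theorem gsl_root_iff (α γ qs ρ σ n t : ℝ) (hγ : 0 < γ) (hqs : 1 < qs) (hρ : 0 < ρ) (ht : 0 < t) :
    t ^ (2 * qs - 1) + qs * (σ - γ * α) / (γ * ρ) * t ^ (qs - 1)
          + qs / ρ ^ 2 * t - qs * n / (γ * ρ ^ 2) = 0 ↔
    ρ * t ^ (qs - 1) * (σ + γ * (ρ * t ^ qs / qs - α)) + γ * t - n = 0 := by
  have e : t ^ (2 * qs - 1) = t ^ (qs - 1) * t ^ qs := by
    rw [← Real.rpow_add ht]; congr 1; ring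
  have hq0 : 0 < qs := by linarith
  have : t ^ (2 * qs - 1) + qs * (σ - γ * α) / (γ * ρ) * t ^ (qs - 1)
          + qs / ρ ^ 2 * t - qs * n / (γ * ρ ^ 2) =
      (qs / (γ * ρ ^ 2)) *
        (ρ * t ^ (qs - 1) * (σ + γ * (ρ * t ^ qs / qs - α)) + γ * t - n) := by
    rw [e]; field_simp; ring
  rw [this, mul_eq_zero, or_iff_right (by positivity)]

theorem gsl_cond (α γ qs ρ σ n : ℝ) (hγ : 0 < γ) (hqs : 1 < qs) (hn : 0 ≤ n) :
    (qs * γ ^ (qs - 1) * σ + ρ * n ^ qs ≤ qs * γ ^ qs * α ↔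
      σ + γ * (ρ * (n / γ) ^ qs / qs - α) ≤ 0) := by
  have hq0 : 0 < qs := by linarith
  have hg : 0 < γ ^ (qs - 1) := by positivity
  have e : γ ^ qs = γ ^ (qs - 1) * γ := by rw [← Real.rpow_add_one hγ.ne']; congr 1; ring
  have : qs * γ ^ (qs - 1) * σ + ρ * n ^ qs - qs * γ ^ qs * α =
      (qs * γ ^ (qs - 1)) * (σ + γ * (ρ * (n / γ) ^ qs / qs - α)) := by
    rw [Real.div_rpow hn hγ.le, e]; field_simp; ring
  rw [← sub_nonpos, this]
  constructor
  · intro h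
    by_contra! h'
    have : 0 < qs * γ ^ (qs - 1) * (σ + γ * (ρ * (n / γ) ^ qs / qs - α)) := by positivity
    linarith
  · intro h
    exact mul_nonpos_of_nonneg_of_nonpos (by positivity) h

theorem gsl_mono (α γ qs ρ σ s t : ℝ) (hγ : 0 < γ) (hqs : 1 < qs) (hρ : 0 < ρ) (hs : 0 ≤ s)
    (hst : s ≤ t) :
    σ + γ * (ρ * s ^ qs / qs - α) ≤ σ + γ * (ρ * t ^ qs / qs - α) := by
  have := Real.rpow_le_rpow hs hst (show 0 ≤ qs by linarith)
  gcongr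

theorem gsl_root_pos (α γ qs ρ σ n t : ℝ) (hγ : 0 < γ) (hqs : 1 < qs) (hρ : 0 < ρ) (hn : 0 < n)
    (hc : 0 < σ + γ * (ρ * (n / γ) ^ qs / qs - α)) (ht : 0 < t)
    (h : ρ * t ^ (qs - 1) * (σ + γ * (ρ * t ^ qs / qs - α)) + γ * t - n = 0) :
    0 < σ + γ * (ρ * t ^ qs / qs - α) := by
  by_contra! h'
  have h1 : ρ * t ^ (qs - 1) * (σ + γ * (ρ * t ^ qs / qs - α)) ≤ 0 :=
    mul_nonpos_of_nonneg_of_nonpos (by positivity) h'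
  have h2 : n / γ ≤ t := by rw [div_le_iff₀ hγ]; linarith
  have := gsl_mono α γ qs ρ σ (n / γ) t hγ hqs hρ (by positivity) h2
  linarith

theorem gsl_root_le (α γ qs ρ σ n s t : ℝ) (hγ : 0 < γ) (hqs : 1 < qs) (hρ : 0 < ρ) (hn : 0 < n)
    (hc : 0 < σ + γ * (ρ * (n / γ) ^ qs / qs - α)) (ht : 0 < t) (hs : 0 < s)
    (h : ρ * t ^ (qs - 1) * (σ + γ * (ρ * t ^ qs / qs - α)) + γ * t - n = 0)
    (h' : ρ * s ^ (qs - 1) * (σ + γ * (ρ * s ^ qs / qs - α)) + γ * s - n = 0) : t ≤ s := by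
  by_contra! hlt
  have h1 := gsl_root_pos α γ qs ρ σ n s hγ hqs hρ hn hc hs h'
  have h2 := gsl_mono α γ qs ρ σ s t hγ hqs hρ hs.le hlt.le
  have h3 := Real.rpow_le_rpow hs.le hlt.le (show 0 ≤ qs - 1 by linarith)
  have h4 : ρ * s ^ (qs - 1) * (σ + γ * (ρ * s ^ qs / qs - α)) ≤
      ρ * t ^ (qs - 1) * (σ + γ * (ρ * t ^ qs / qs - α)) :=
    mul_le_mul (mul_le_mul_of_nonneg_left h3 hρ.le) h2 h1.le (by positivity)
  nlinarith

theorem gsl_root_exists (α γ qs ρ σ n : ℝ) (hγ : 0 < γ) (hqs : 1 < qs) (hρ : 0 < ρ) (hn : 0 < n)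
    (hc : 0 < σ + γ * (ρ * (n / γ) ^ qs / qs - α)) :
    ∃ t, 0 < t ∧ ρ * t ^ (qs - 1) * (σ + γ * (ρ * t ^ qs / qs - α)) + γ * t - n = 0 := by
  have hcont : Continuous
      (fun t : ℝ => ρ * t ^ (qs - 1) * (σ + γ * (ρ * t ^ qs / qs - α)) + γ * t - n) := by
    have c1 : Continuous (fun t : ℝ => t ^ (qs - 1)) :=
      Real.continuous_rpow_const (by linarith)
    have c2 : Continuous (fun t : ℝ => t ^ qs) :=
      Real.continuous_rpow_const (by linarith)
    fun_prop
  have hng : 0 < n / γ := by positivity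
  have hiv := intermediate_value_Icc hng.le hcont.continuousOn
  have h0 : (0 : ℝ) ^ (qs - 1) = 0 := Real.zero_rpow (by linarith)
  have hmem := hiv (show (0 : ℝ) ∈ _ from ⟨by simp only [h0]; linarith, by
    have : γ * (n / γ) = n := by field_simp
    simp only [this]
    have : 0 < ρ * (n / γ) ^ (qs - 1) * (σ + γ * (ρ * (n / γ) ^ qs / qs - α)) := by positivity
    linarith⟩)
  obtain ⟨t, ht, h⟩ := hmem
  refine ⟨t, lt_of_le_of_ne ht.1 ?_, h⟩
  rintro rfl
  simp only [h0] at h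
  linarith

end helpers

/-- Proximity operator of the perspective of the generalized scaled lasso
function `φ = α + ‖·‖^q/κ`. -/
theorem prox_generalized_scaled_lasso
    {H : Type*} [NormedAddCommGroup H] [InnerProductSpace ℝ H] [CompleteSpace H]
    (α γ κ q : ℝ) (hα : 0 < α) (hγ : 0 < γ) (hκ : 0 < κ) (hq : 1 < q)
    (qs ρ : ℝ) (hqs : qs = q / (q - 1)) (hρ : ρ = (κ / q) ^ (qs - 1))
    (σ : ℝ) (x : H) :
    (qs * γ ^ (qs - 1) * σ + ρ * ‖x‖ ^ qs ≤ qs * γ ^ qs * α →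
      ∀ p : ℝ × H,
        IsProx (fun w => (γ : EReal) * perspR (fun v : H => α + ‖v‖ ^ q / κ) w)
            (σ, x) p ↔ p = (0, 0)) ∧
    (qs * γ ^ (qs - 1) * σ + ρ * ‖x‖ ^ qs > qs * γ ^ qs * α → x ≠ 0 →
      (∃! t : ℝ, 0 < t ∧
          t ^ (2 * qs - 1) + qs * (σ - γ * α) / (γ * ρ) * t ^ (qs - 1)
            + qs / ρ ^ 2 * t - qs * ‖x‖ / (γ * ρ ^ 2) = 0) ∧
      ∀ t : ℝ, 0 < t →
        t ^ (2 * qs - 1) + qs * (σ - γ * α) / (γ * ρ) * t ^ (qs - 1)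
          + qs / ρ ^ 2 * t - qs * ‖x‖ / (γ * ρ ^ 2) = 0 →
        ∀ p : ℝ × H,
          IsProx (fun w => (γ : EReal) * perspR (fun v : H => α + ‖v‖ ^ q / κ) w)
              (σ, x) p ↔
            p = (σ + γ * (ρ * t ^ qs / qs - α), x - γ • ((t / ‖x‖) • x))) ∧
    (qs * γ ^ (qs - 1) * σ + ρ * ‖x‖ ^ qs > qs * γ ^ qs * α → x = 0 →
      ∀ p : ℝ × H,
        IsProx (fun w => (γ : EReal) * perspR (fun v : H => α + ‖v‖ ^ q / κ) w)
            (σ, x) p ↔ p = (σ - γ * α, (0 : H))) := by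
  have hq1 : 0 < q - 1 := by linarith
  have hqs1 : 1 < qs := by rw [hqs, lt_div_iff₀ hq1]; linarith
  have hk : 0 < κ / q := div_pos hκ (by linarith)
  have hρ0 : 0 < ρ := by rw [hρ]; positivity
  have hcond := gsl_cond α γ qs ρ σ ‖x‖ hγ hqs1 (norm_nonneg x)
  refine ⟨?_, ?_, ?_⟩
  · intro h p
    rw [hcond] at h
    refine gsl_prox _ γ hγ (σ, x) (0, 0) (σ / γ) (γ⁻¹ • x) ?_ ?_ ?_ ?_ p
    · simp only; field_simp; ring
    · simp [smul_smul, hγ.ne']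
    · rw [gsl_zero α κ q hq]; simp
    · apply gsl_lower α κ q qs ρ hκ hq hqs hρ
      rw [norm_smul, Real.norm_of_nonneg (by positivity), inv_mul_eq_div]
      have : σ / γ + (ρ * (‖x‖ / γ) ^ qs / qs - α) =
        (σ + γ * (ρ * (‖x‖ / γ) ^ qs / qs - α)) / γ := by field_simp
      rw [this]
      exact div_nonpos_of_nonpos_of_nonneg h hγ.le
  · intro h hx
    have hn : 0 < ‖x‖ := norm_pos_iff.mpr hx
    have hc := not_le.mp (mt hcond.mpr (not_le.mpr h))
    constructor
    · obtain ⟨t, ht, hr⟩ := gsl_root_exists α γ qs ρ σ ‖x‖ hγ hqs1 hρ0 hn hc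
      refine ⟨t, ⟨ht, (gsl_root_iff α γ qs ρ σ ‖x‖ t hγ hqs1 hρ0 ht).mpr hr⟩, ?_⟩
      rintro s ⟨hs, hs'⟩
      rw [gsl_root_iff α γ qs ρ σ ‖x‖ s hγ hqs1 hρ0 hs] at hs'
      exact le_antisymm (gsl_root_le α γ qs ρ σ ‖x‖ t s hγ hqs1 hρ0 hn hc hs ht hs' hr)
        (gsl_root_le α γ qs ρ σ ‖x‖ s t hγ hqs1 hρ0 hn hc ht hs hr hs')
    · intro t ht hr p
      rw [gsl_root_iff α γ qs ρ σ ‖x‖ t hγ hqs1 hρ0 ht] at hr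
      have hη := gsl_root_pos α γ qs ρ σ ‖x‖ t hγ hqs1 hρ0 hn hc ht hr
      have hu : ‖(t / ‖x‖) • x‖ = t := by
        rw [norm_smul, Real.norm_of_nonneg (by positivity)]; field_simp
      refine gsl_prox _ γ hγ (σ, x) _ (α - ρ * ‖(t / ‖x‖) • x‖ ^ qs / qs)
        ((t / ‖x‖) • x) ?_ ?_ ?_ ?_ p
      · rw [hu]; simp only; ring
      · simp
      · apply gsl_eq α κ q qs ρ hκ hq hqs hρ _ _ _ hη
        rw [hu]
        have e1 : t ^ (qs - 1) = t ^ (qs - 2) * t := by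
          rw [← Real.rpow_add_one ht.ne']; congr 1; ring
        rw [smul_smul, smul_smul, smul_smul]
        nth_rewrite 1 [← one_smul ℝ x]
        rw [← sub_smul]
        congr 1
        rw [e1] at hr
        field_simp
        field_simp at hr
        linarith
      · apply gsl_lower α κ q qs ρ hκ hq hqs hρ
        linarith
  · intro h hx p
    have hc := not_le.mp (mt hcond.mpr (not_le.mpr h))
    subst hx
    have hz : (0 : ℝ) ^ qs = 0 := Real.zero_rpow (by linarith)
    simp only [norm_zero, zero_div, hz, mul_zero] at hc
    refine gsl_prox _ γ hγ (σ, 0) _ (α - ρ * ‖(0 : H)‖ ^ qs / qs) 0 ?_ ?_ ?_ ?_ p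
    · simp [hz]
    · simp
    · apply gsl_eq α κ q qs ρ hκ hq hqs hρ _ _ _ (by linarith)
      simp
    · apply gsl_lower α κ q qs ρ hκ hq hqs hρ
      linarith
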